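/- Weak completeness of N(LTL∇) with respect to the Hilbert axiomatization H(LTL): for every LTL-formula A that is a theorem of H(LTL), A is LTL-derivable in N(LTL∇), i.e., ⊢LTL A. In particular (since H(LTL) is weakly complete for LTL), for every LTL-formula A, if ⊨LTL A then ⊢LTL A. -/

import Mathlib

/-! ## LTL∇-formulas: `A ::= p | ⊥ | A ⊃ A | G A | X A | ∇ A` -/
inductive NablaFormula (P : Type) : Type
  | atom  : P → NablaFormula P
  | bot   : NablaFormula P
  | imp   : NablaFormula P → NablaFormula P → NablaFormula P
  | G     : NablaFormula P → NablaFormula P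
  | X     : NablaFormula P → NablaFormula P
  | nabla : NablaFormula P → NablaFormula P

namespace NablaFormula
variable {P : Type}
/-- `¬A ≡ A ⊃ ⊥` -/
def neg (A : NablaFormula P) : NablaFormula P := imp A bot
/-- `A ∨ B ≡ ¬A ⊃ B` -/
def or (A B : NablaFormula P) : NablaFormula P := imp (neg A) B
/-- `A ∧ B ≡ ¬(¬A ∨ ¬B)` -/
def and (A B : NablaFormula P) : NablaFormula P := neg (or (neg A) (neg B))
/-- `F A ≡ ¬G¬A` -/
def F (A : NablaFormula P) : NablaFormula P := neg (G (neg A))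
end NablaFormula

/-- Truth of an LTL∇-formula at an observation sequence, in the LTL-model given by
the valuation `V : ℕ → P → Prop` (the time structure is the standard structure of ℕ).
A nonempty observation sequence `[n_0, …, n_k]` is represented *in reverse* by its
last element `n = n_k` together with the reversed remainder `ρ = [n_{k-1}, …, n_0]`;
thus `NablaSat V A n ρ` means `M, [n_0, …, n_{k-1}, n] ⊨∇ A`. -/
def NablaSat {P : Type} (V : ℕ → P → Prop) : NablaFormula P → ℕ → List ℕ → Prop
  | .atom p, n, _ => V n p
  | .bot, _, _ => False
  | .imp A B, n, ρ => NablaSat V A n ρ → NablaSat V B n ρ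
  | .G A, n, ρ => ∀ m, n ≤ m → NablaSat V A m (n :: ρ)
  | .X A, n, ρ => NablaSat V A (n + 1) (n :: ρ)
  | .nabla A, n, [] => NablaSat V A n []
  | .nabla A, n, n' :: ρ => ∀ m, n' ≤ m → m ≤ n → NablaSat V A m (n' :: ρ)

/-! ## LTL-formulas: `A ::= p | ⊥ | A ⊃ A | G A | X A | A U B` -/
inductive LTLFormula (P : Type) : Type
  | atom : P → LTLFormula P
  | bot  : LTLFormula P
  | imp  : LTLFormula P → LTLFormula P → LTLFormula P
  | G    : LTLFormula P → LTLFormula P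
  | X    : LTLFormula P → LTLFormula P
  | U    : LTLFormula P → LTLFormula P → LTLFormula P

namespace LTLFormula
variable {P : Type}
def neg (A : LTLFormula P) : LTLFormula P := imp A bot
def or (A B : LTLFormula P) : LTLFormula P := imp (neg A) B
def and (A B : LTLFormula P) : LTLFormula P := neg (or (neg A) (neg B))
def F (A : LTLFormula P) : LTLFormula P := neg (G (neg A))
def iff (A B : LTLFormula P) : LTLFormula P := and (imp A B) (imp B A)
end LTLFormula

/-- Standard LTL truth at a time instant `n` in the model with valuation `V`. -/
def LTLSat {P : Type} (V : ℕ → P → Prop) : LTLFormula P → ℕ → Prop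
  | .atom p, n => V n p
  | .bot, _ => False
  | .imp A B, n => LTLSat V A n → LTLSat V B n
  | .G A, n => ∀ m, n ≤ m → LTLSat V A m
  | .X A, n => LTLSat V A (n + 1)
  | .U A B, n => ∃ n', n ≤ n' ∧ LTLSat V B n' ∧ ∀ m, n ≤ m → m < n' → LTLSat V A m

/-- The translation `(·)*` from LTL into LTL∇:
`(A U B)* = B* ∨ (F (X B* ∧ ∇ A*))`. -/
def trNabla {P : Type} : LTLFormula P → NablaFormula P
  | .atom p => .atom p
  | .bot => .bot
  | .imp A B => .imp (trNabla A) (trNabla B)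
  | .G A => .G (trNabla A)
  | .X A => .X (trNabla A)
  | .U A B => NablaFormula.or (trNabla B)
      (NablaFormula.F (NablaFormula.and (.X (trNabla B)) (.nabla (trNabla A))))

/-! ## LTL^l- and LTL^{l∇}-formulas (mutual grammar) -/
mutual
  /-- LTL^l-formulas: `A^l ::= p | ⊥ | A^l ⊃ A^l | G A^∇ | X A^∇`. -/
  inductive IsLocal {P : Type} : NablaFormula P → Prop
    | atom (p : P) : IsLocal (.atom p)
    | bot : IsLocal .bot
    | imp {A B : NablaFormula P} : IsLocal A → IsLocal B → IsLocal (.imp A B)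
    | G {A : NablaFormula P} : IsHist A → IsLocal (.G A)
    | X {A : NablaFormula P} : IsHist A → IsLocal (.X A)
  /-- LTL^{l∇}-formulas: `A^∇ ::= A^l | A^∇ ⊃ A^∇ | ∇ A^∇`. -/
  inductive IsHist {P : Type} : NablaFormula P → Prop
    | ofLocal {A : NablaFormula P} : IsLocal A → IsHist A
    | imp {A B : NablaFormula P} : IsHist A → IsHist B → IsHist (.imp A B)
    | nabla {A : NablaFormula P} : IsHist A → IsHist (.nabla A)
end

/-! ## The labeled natural deduction system N(LTL∇).
Labels are natural numbers (a denumerable set). A labeled formula `α : A` with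
`α = b_0 … b_{k-1} b` is represented in reverse, as the last label `b` together
with the reversed prefix `ρ = [b_{k-1}, …, b_0]`. -/

/-- Generic (labeled or relational) formulas. -/
inductive GenForm (P : Type) : Type
  | lab : ℕ → List ℕ → NablaFormula P → GenForm P  -- `lab b ρ A` is `(ρ.reverse)b : A`
  | le  : ℕ → ℕ → GenForm P                         -- `b ⩽ c`
  | lt  : ℕ → ℕ → GenForm P                         -- `b ◁ c` (immediate successor)

/-- The labels occurring in a generic formula. -/
def GenForm.labels {P : Type} : GenForm P → Set ℕ
  | .lab b ρ _ => insert b {x | x ∈ ρ}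
  | .le b c => {b, c}
  | .lt b c => {b, c}

/-- `x` does not occur in any formula of `Φ`. -/
def FreshIn {P : Type} (x : ℕ) (Φ : Set (GenForm P)) : Prop :=
  ∀ ψ ∈ Φ, x ∉ ψ.labels

/-- Substitution `φ[c/b]` of the label `c` for the label `b`: `φ.subst b c`. -/
def GenForm.subst {P : Type} : GenForm P → ℕ → ℕ → GenForm P
  | .lab d ρ A, b, c => .lab (if d = b then c else d) (ρ.map fun x => if x = b then c else x) A
  | .le d e, b, c => .le (if d = b then c else d) (if e = b then c else e)
  | .lt d e, b, c => .lt (if d = b then c else d) (if e = b then c else e)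

/-- Derivability in N(LTL∇): `Deriv Φ φ` means that there is a derivation of `φ`
whose open assumptions are all contained in `Φ`. -/
inductive Deriv {P : Type} : Set (GenForm P) → GenForm P → Prop
  | assume {Φ : Set (GenForm P)} {φ} : φ ∈ Φ → Deriv Φ φ
  | botE {Φ : Set (GenForm P)} {b₁ b₂ ρ₁ ρ₂ A} :
      Deriv (insert (.lab b₁ ρ₁ (A.imp .bot)) Φ) (.lab b₂ ρ₂ .bot) →
      Deriv Φ (.lab b₁ ρ₁ A)
  | impI {Φ : Set (GenForm P)} {b ρ A B} :
      Deriv (insert (.lab b ρ A) Φ) (.lab b ρ B) →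
      Deriv Φ (.lab b ρ (A.imp B))
  | impE {Φ : Set (GenForm P)} {b ρ A B} :
      Deriv Φ (.lab b ρ (A.imp B)) → Deriv Φ (.lab b ρ A) → Deriv Φ (.lab b ρ B)
  | GI {Φ : Set (GenForm P)} {b₁ b₂ ρ A} :
      Deriv (insert (.le b₁ b₂) Φ) (.lab b₂ (b₁ :: ρ) A) →
      b₂ ≠ b₁ → b₂ ∉ ρ → FreshIn b₂ Φ →
      Deriv Φ (.lab b₁ ρ (.G A))
  | GE {Φ : Set (GenForm P)} {b₁ b₂ ρ A} :
      Deriv Φ (.lab b₁ ρ (.G A)) → Deriv Φ (.le b₁ b₂) →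
      Deriv Φ (.lab b₂ (b₁ :: ρ) A)
  | XI {Φ : Set (GenForm P)} {b₁ b₂ ρ A} :
      Deriv (insert (.lt b₁ b₂) Φ) (.lab b₂ (b₁ :: ρ) A) →
      b₂ ≠ b₁ → b₂ ∉ ρ → FreshIn b₂ Φ →
      Deriv Φ (.lab b₁ ρ (.X A))
  | XE {Φ : Set (GenForm P)} {b₁ b₂ ρ A} :
      Deriv Φ (.lab b₁ ρ (.X A)) → Deriv Φ (.lt b₁ b₂) →
      Deriv Φ (.lab b₂ (b₁ :: ρ) A)
  | nablaI {Φ : Set (GenForm P)} {b₁ b₂ b₃ ρ A} :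
      Deriv (insert (.le b₁ b₂) (insert (.le b₂ b₃) Φ)) (.lab b₂ (b₁ :: ρ) A) →
      b₂ ≠ b₁ → b₂ ≠ b₃ → b₂ ∉ ρ → FreshIn b₂ Φ →
      Deriv Φ (.lab b₃ (b₁ :: ρ) (.nabla A))
  | nablaE {Φ : Set (GenForm P)} {b₁ b₂ b₃ ρ A} :
      Deriv Φ (.lab b₃ (b₁ :: ρ) (.nabla A)) →
      Deriv Φ (.le b₁ b₂) → Deriv Φ (.le b₂ b₃) →
      Deriv Φ (.lab b₂ (b₁ :: ρ) A)
  | last {Φ : Set (GenForm P)} {b ρ ρ' A} :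
      Deriv Φ (.lab b ρ' A) → IsLocal A →
      Deriv Φ (.lab b ρ A)
  | serLt {Φ : Set (GenForm P)} {b₁ b₂ b ρ A} :
      Deriv (insert (.lt b₁ b₂) Φ) (.lab b ρ A) →
      b₂ ≠ b₁ → b₂ ≠ b → b₂ ∉ ρ → FreshIn b₂ Φ →
      Deriv Φ (.lab b ρ A)
  | linLt {Φ : Set (GenForm P)} {b₁ b₂ b₃ φ b ρ A} :
      Deriv Φ (.lt b₁ b₂) → Deriv Φ (.lt b₁ b₃) → Deriv Φ φ →
      Deriv (insert (φ.subst b₂ b₃) Φ) (.lab b ρ A) →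
      Deriv Φ (.lab b ρ A)
  | reflLe {Φ : Set (GenForm P)} {b₁ b ρ A} :
      Deriv (insert (.le b₁ b₁) Φ) (.lab b ρ A) →
      Deriv Φ (.lab b ρ A)
  | transLe {Φ : Set (GenForm P)} {b₁ b₂ b₃ b ρ A} :
      Deriv Φ (.le b₁ b₂) → Deriv Φ (.le b₂ b₃) →
      Deriv (insert (.le b₁ b₃) Φ) (.lab b ρ A) →
      Deriv Φ (.lab b ρ A)
  | eqLe {Φ : Set (GenForm P)} {b₁ b₂ ρ A} :
      Deriv Φ (.le b₁ b₂) → Deriv Φ (.le b₂ b₁) →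
      Deriv Φ (.lab b₁ ρ A) →
      Deriv Φ (.lab b₂ ρ A)
  | splitLe {Φ : Set (GenForm P)} {b₁ b₂ b' φ b ρ A} :
      Deriv Φ (.le b₁ b₂) → Deriv Φ φ →
      Deriv (insert (φ.subst b₁ b₂) Φ) (.lab b ρ A) →
      Deriv (insert (.lt b₁ b') (insert (.le b' b₂) Φ)) (.lab b ρ A) →
      b' ≠ b₁ → b' ≠ b₂ → b' ≠ b → b' ∉ ρ → FreshIn b' Φ →
      Deriv Φ (.lab b ρ A)
  | baseLe {Φ : Set (GenForm P)} {b₁ b₂ b ρ A} :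
      Deriv Φ (.lt b₁ b₂) →
      Deriv (insert (.le b₁ b₂) Φ) (.lab b ρ A) →
      Deriv Φ (.lab b ρ A)
  | ind {Φ : Set (GenForm P)} {b₀ b bi bj ρ A} :
      Deriv Φ (.lab b₀ ρ A) → Deriv Φ (.le b₀ b) →
      Deriv (insert (.le b₀ bi) (insert (.lt bi bj) (insert (.lab bi ρ A) Φ)))
        (.lab bj ρ A) →
      bi ≠ bj → bi ≠ b → bi ≠ b₀ → bi ∉ ρ → FreshIn bi Φ →
      bj ≠ b → bj ≠ b₀ → bj ∉ ρ → FreshIn bj Φ →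
      Deriv Φ (.lab b ρ A)

/-- Satisfaction of generic formulas in a structure `⟨M, I⟩`, where `M` is given
by the valuation `V` and `I : L → ℕ` interprets labels. -/
def GSat {P : Type} (V : ℕ → P → Prop) (I : ℕ → ℕ) : GenForm P → Prop
  | .lab b ρ A => NablaSat V A (I b) (ρ.map I)
  | .le b c => I b ≤ I c
  | .lt b c => I c = I b + 1

/-! ## The Hilbert system H(LTL) -/

/-- Propositional evaluation of an LTL-formula with respect to a valuation `v` on
formulas, treating atoms and formulas with outermost `G`, `X`, `U` as propositional
atoms. `A` is an instance of a propositional tautology iff `propEval v A` for all `v`. -/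
def propEval {P : Type} (v : LTLFormula P → Prop) : LTLFormula P → Prop
  | .atom p => v (.atom p)
  | .bot => False
  | .imp A B => propEval v A → propEval v B
  | .G A => v (.G A)
  | .X A => v (.X A)
  | .U A B => v (.U A B)

/-- Theorems of the Hilbert axiomatization H(LTL). -/
inductive HLTL {P : Type} : LTLFormula P → Prop
  | taut {A : LTLFormula P} : (∀ v : LTLFormula P → Prop, propEval v A) → HLTL A
  | a2 {A B : LTLFormula P} : HLTL (.imp (.G (.imp A B)) (.imp (.G A) (.G B)))
  | a3 {A : LTLFormula P} : HLTL (LTLFormula.iff (.X A.neg) (LTLFormula.X A).neg)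
  | a4 {A B : LTLFormula P} : HLTL (.imp (.X (.imp A B)) (.imp (.X A) (.X B)))
  | a5 {A : LTLFormula P} : HLTL (.imp (.G A) (LTLFormula.and A (.X (.G A))))
  | a6 {A : LTLFormula P} : HLTL (.imp (.G (.imp A (.X A))) (.imp A (.G A)))
  | a7 {A B : LTLFormula P} :
      HLTL (LTLFormula.iff (.U A B) (LTLFormula.or B (LTLFormula.and A (.X (.U A B)))))
  | a8 {A B : LTLFormula P} : HLTL (.imp (.U A B) (LTLFormula.F B))
  | mp {A B : LTLFormula P} : HLTL (.imp A B) → HLTL A → HLTL B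
  | necX {A : LTLFormula P} : HLTL A → HLTL (.X A)
  | necG {A : LTLFormula P} : HLTL A → HLTL (.G A)

/-! ## Part 1: derivability, stable under finite weakening -/

/-- Derivability from every finite superset of `Φ`. -/
def DD {P : Type} (Φ : Set (GenForm P)) (φ : GenForm P) : Prop :=
  ∀ Ψ : Set (GenForm P), Ψ.Finite → Φ ⊆ Ψ → Deriv Ψ φ

theorem labels_finite {P : Type} (φ : GenForm P) : φ.labels.Finite := by
  cases φ with
  | lab b ρ A => exact (List.finite_toSet ρ).insert b
  | le b c => exact (Set.finite_singleton c).insert b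
  | lt b c => exact (Set.finite_singleton c).insert b

theorem exists_fresh {P : Type} {Ψ : Set (GenForm P)} (h : Ψ.Finite) (l : List ℕ) :
    ∃ x : ℕ, x ∉ l ∧ FreshIn x Ψ := by
  have h1 : (⋃ ψ ∈ Ψ, ψ.labels).Finite := h.biUnion fun ψ _ => labels_finite ψ
  obtain ⟨x, hx⟩ := (h1.union (List.finite_toSet l)).exists_notMem
  refine ⟨x, fun hl => hx (Or.inr hl), fun ψ hψ hxx => hx (Or.inl ?_)⟩
  simp only [Set.mem_iUnion]
  exact ⟨ψ, hψ, hxx⟩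

namespace DD
variable {P : Type} {Φ : Set (GenForm P)}

theorem mono {Φ' : Set (GenForm P)} {φ} (h : DD Φ φ) (hs : Φ ⊆ Φ') : DD Φ' φ :=
  fun Ψ hf hΨ => h Ψ hf (hs.trans hΨ)

theorem assume {φ} (h : φ ∈ Φ) : DD Φ φ := fun _ _ hΨ => Deriv.assume (hΨ h)

theorem botE {b₁ b₂ ρ₁ ρ₂ A}
    (h : DD (insert (.lab b₁ ρ₁ (A.neg)) Φ) (.lab b₂ ρ₂ .bot)) : DD Φ (.lab b₁ ρ₁ A) :=
  fun _ hf hΨ => Deriv.botE (h _ (hf.insert _) (Set.insert_subset_insert hΨ))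

theorem exf {b₁ b₂ ρ₁ ρ₂ A} (h : DD Φ (.lab b₂ ρ₂ .bot)) : DD Φ (.lab b₁ ρ₁ A) :=
  botE (h.mono (Set.subset_insert _ _))

theorem impI {b ρ A B} (h : DD (insert (.lab b ρ A) Φ) (.lab b ρ B)) :
    DD Φ (.lab b ρ (.imp A B)) :=
  fun _ hf hΨ => Deriv.impI (h _ (hf.insert _) (Set.insert_subset_insert hΨ))

theorem impE {b ρ A B} (h : DD Φ (.lab b ρ (.imp A B))) (h' : DD Φ (.lab b ρ A)) :
    DD Φ (.lab b ρ B) :=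
  fun Ψ hf hΨ => Deriv.impE (h Ψ hf hΨ) (h' Ψ hf hΨ)

theorem negI {b ρ A b' ρ'} (h : DD (insert (.lab b ρ A) Φ) (.lab b' ρ' .bot)) :
    DD Φ (.lab b ρ (A.neg)) := impI (exf h)

theorem negE {b ρ A} (h : DD Φ (.lab b ρ A.neg)) (h' : DD Φ (.lab b ρ A)) :
    DD Φ (.lab b ρ .bot) := impE h h'

theorem cut {φ b ρ A} (h : DD (insert φ Φ) (.lab b ρ A)) (h' : DD Φ φ) : DD Φ (.lab b ρ A) := by
  intro Ψ hf hΨ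
  have h1 := h (insert φ Ψ) (hf.insert _) (Set.insert_subset_insert hΨ)
  have h2 := h' Ψ hf hΨ
  cases φ with
  | lab c σ C =>
    obtain ⟨x, hx, hfr⟩ := exists_fresh hf (0 :: c :: b :: (σ ++ ρ))
    simp at hx
    refine Deriv.serLt (b₁ := 0) (b₂ := x) ?_ (by tauto) (by tauto) (by tauto) hfr
    have m1 : Deriv (insert (GenForm.lt 0 x) Ψ) (.lab c σ C) :=
      h' _ (hf.insert _) (hΨ.trans (Set.subset_insert _ _))
    have key' : (GenForm.lab c σ C).subst x x = .lab c σ C := by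
      have : (fun y : ℕ => if y = x then x else y) = id := by
        funext y; by_cases hy : y = x <;> simp [hy]
      by_cases hc : c = x <;> simp [GenForm.subst, this, hc]
    refine Deriv.linLt (b₁ := 0) (b₂ := x) (b₃ := x) (φ := .lab c σ C)
      (Deriv.assume (by simp)) (Deriv.assume (by simp)) m1 ?_
    rw [key']
    exact h _ ((hf.insert _).insert _)
      (Set.insert_subset_insert (hΨ.trans (Set.subset_insert _ _)))
  | le c d =>
    cases h2 with
    | assume hm => rwa [Set.insert_eq_of_mem hm] at h1
  | lt c d =>
    cases h2 with
    | assume hm => rwa [Set.insert_eq_of_mem hm] at h1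

theorem byCases {b ρ b' ρ' A B} (h : DD (insert (.lab b ρ A) Φ) (.lab b' ρ' B))
    (h' : DD (insert (.lab b ρ A.neg) Φ) (.lab b' ρ' B)) : DD Φ (.lab b' ρ' B) := by
  refine botE (b₂ := b') (ρ₂ := ρ') (cut (φ := .lab b ρ A.neg) ?_ ?_)
  · refine negE (assume (φ := .lab b' ρ' B.neg) (by simp)) (h'.mono ?_)
    exact Set.insert_subset_insert (Set.subset_insert _ _)
  · refine negI (b' := b') (ρ' := ρ') ?_
    refine negE (assume (φ := .lab b' ρ' B.neg) (by simp)) (h.mono ?_)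
    exact Set.insert_subset_insert (Set.subset_insert _ _)

theorem andI {b ρ A B} (h : DD Φ (.lab b ρ A)) (h' : DD Φ (.lab b ρ B)) :
    DD Φ (.lab b ρ (A.and B)) := by
  refine negI (b' := b) (ρ' := ρ) ?_
  have hB : DD (insert (.lab b ρ (NablaFormula.or A.neg B.neg)) Φ) (.lab b ρ B) :=
    h'.mono (Set.subset_insert _ _)
  refine negE (impE (assume (Set.mem_insert _ _)) ?_) hB
  refine negI (b' := b) (ρ' := ρ) ?_
  refine negE (assume (Set.mem_insert _ _)) (h.mono ?_)
  exact (Set.subset_insert _ _).trans (Set.subset_insert _ _)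

theorem andE1 {b ρ A B} (h : DD Φ (.lab b ρ (NablaFormula.and A B))) : DD Φ (.lab b ρ A) := by
  refine botE (b₂ := b) (ρ₂ := ρ) ?_
  refine negE (h.mono (Set.subset_insert _ _)) ?_
  refine impI (exf (b₂ := b) (ρ₂ := ρ) ?_)
  exact negE (assume (Set.mem_insert _ _)) (assume (by simp))

theorem andE2 {b ρ A B} (h : DD Φ (.lab b ρ (NablaFormula.and A B))) : DD Φ (.lab b ρ B) := by
  refine botE (b₂ := b) (ρ₂ := ρ) ?_
  refine negE (h.mono (Set.subset_insert _ _)) ?_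
  exact impI (assume (by simp))

theorem last {b ρ ρ' A} (h : DD Φ (.lab b ρ' A)) (hA : IsLocal A) : DD Φ (.lab b ρ A) :=
  fun Ψ hf hΨ => Deriv.last (h Ψ hf hΨ) hA

theorem GI {b₁ ρ A} (h : ∀ b₂, DD (insert (.le b₁ b₂) Φ) (.lab b₂ (b₁ :: ρ) A)) :
    DD Φ (.lab b₁ ρ (.G A)) := by
  intro Ψ hf hΨ
  obtain ⟨x, hx, hfr⟩ := exists_fresh hf (b₁ :: ρ)
  simp at hx
  exact Deriv.GI (h x _ (hf.insert _) (Set.insert_subset_insert hΨ)) hx.1 hx.2 hfr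

theorem XI {b₁ ρ A} (h : ∀ b₂, DD (insert (.lt b₁ b₂) Φ) (.lab b₂ (b₁ :: ρ) A)) :
    DD Φ (.lab b₁ ρ (.X A)) := by
  intro Ψ hf hΨ
  obtain ⟨x, hx, hfr⟩ := exists_fresh hf (b₁ :: ρ)
  simp at hx
  exact Deriv.XI (h x _ (hf.insert _) (Set.insert_subset_insert hΨ)) hx.1 hx.2 hfr

theorem GE {b₁ b₂ ρ A} (h : DD Φ (.lab b₁ ρ (.G A))) (h' : DD Φ (.le b₁ b₂)) :
    DD Φ (.lab b₂ (b₁ :: ρ) A) :=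
  fun Ψ hf hΨ => Deriv.GE (h Ψ hf hΨ) (h' Ψ hf hΨ)

theorem XE {b₁ b₂ ρ A} (h : DD Φ (.lab b₁ ρ (.X A))) (h' : DD Φ (.lt b₁ b₂)) :
    DD Φ (.lab b₂ (b₁ :: ρ) A) :=
  fun Ψ hf hΨ => Deriv.XE (h Ψ hf hΨ) (h' Ψ hf hΨ)

theorem nablaI {b₁ b₃ ρ A}
    (h : ∀ b₂, DD (insert (.le b₁ b₂) (insert (.le b₂ b₃) Φ)) (.lab b₂ (b₁ :: ρ) A)) :
    DD Φ (.lab b₃ (b₁ :: ρ) (.nabla A)) := by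
  intro Ψ hf hΨ
  obtain ⟨x, hx, hfr⟩ := exists_fresh hf (b₁ :: b₃ :: ρ)
  simp at hx
  exact Deriv.nablaI (h x _ ((hf.insert _).insert _)
    (Set.insert_subset_insert (Set.insert_subset_insert hΨ))) hx.1 hx.2.1 hx.2.2 hfr

theorem nablaE {b₁ b₂ b₃ ρ A} (h : DD Φ (.lab b₃ (b₁ :: ρ) (.nabla A)))
    (h1 : DD Φ (.le b₁ b₂)) (h2 : DD Φ (.le b₂ b₃)) : DD Φ (.lab b₂ (b₁ :: ρ) A) :=
  fun Ψ hf hΨ => Deriv.nablaE (h Ψ hf hΨ) (h1 Ψ hf hΨ) (h2 Ψ hf hΨ)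

theorem ser (b₁ : ℕ) {b ρ A} (h : ∀ b₂, DD (insert (.lt b₁ b₂) Φ) (.lab b ρ A)) :
    DD Φ (.lab b ρ A) := by
  intro Ψ hf hΨ
  obtain ⟨x, hx, hfr⟩ := exists_fresh hf (b₁ :: b :: ρ)
  simp at hx
  exact Deriv.serLt (h x _ (hf.insert _) (Set.insert_subset_insert hΨ)) hx.1 hx.2.1 hx.2.2 hfr

theorem lin {b₁ b₂ b₃ φ b ρ A} (h1 : DD Φ (.lt b₁ b₂)) (h2 : DD Φ (.lt b₁ b₃)) (h3 : DD Φ φ)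
    (h : DD (insert (φ.subst b₂ b₃) Φ) (.lab b ρ A)) : DD Φ (.lab b ρ A) :=
  fun Ψ hf hΨ => Deriv.linLt (h1 Ψ hf hΨ) (h2 Ψ hf hΨ) (h3 Ψ hf hΨ)
    (h _ (hf.insert _) (Set.insert_subset_insert hΨ))

theorem linL {b₁ b₂ b₃ ρ A} (h1 : DD Φ (.lt b₁ b₂)) (h2 : DD Φ (.lt b₁ b₃))
    (h3 : DD Φ (.lab b₂ [] A)) (hA : IsLocal A) : DD Φ (.lab b₃ ρ A) :=
  lin h1 h2 h3 (last (ρ' := []) (assume (by simp [GenForm.subst])) hA)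

theorem linLe {b₁ b₂ b₃ c b ρ A} (h1 : DD Φ (.lt b₁ b₂)) (h2 : DD Φ (.lt b₁ b₃))
    (h3 : DD Φ (.le b₂ c)) (hc : b₂ ≠ c) (h : DD (insert (.le b₃ c) Φ) (.lab b ρ A)) :
    DD Φ (.lab b ρ A) :=
  lin h1 h2 h3 (by simpa [GenForm.subst, hc.symm] using h)

theorem refl (b₁ : ℕ) {b ρ A} (h : DD (insert (.le b₁ b₁) Φ) (.lab b ρ A)) :
    DD Φ (.lab b ρ A) :=
  fun _ hf hΨ => Deriv.reflLe (h _ (hf.insert _) (Set.insert_subset_insert hΨ))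

theorem trans {b₁ b₂ b₃ b ρ A} (h1 : DD Φ (.le b₁ b₂)) (h2 : DD Φ (.le b₂ b₃))
    (h : DD (insert (.le b₁ b₃) Φ) (.lab b ρ A)) : DD Φ (.lab b ρ A) :=
  fun Ψ hf hΨ => Deriv.transLe (h1 Ψ hf hΨ) (h2 Ψ hf hΨ)
    (h _ (hf.insert _) (Set.insert_subset_insert hΨ))

theorem eqLe {b₁ b₂ ρ A} (h1 : DD Φ (.le b₁ b₂)) (h2 : DD Φ (.le b₂ b₁))
    (h : DD Φ (.lab b₁ ρ A)) : DD Φ (.lab b₂ ρ A) :=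
  fun Ψ hf hΨ => Deriv.eqLe (h1 Ψ hf hΨ) (h2 Ψ hf hΨ) (h Ψ hf hΨ)

theorem base {b₁ b₂ b ρ A} (h1 : DD Φ (.lt b₁ b₂))
    (h : DD (insert (.le b₁ b₂) Φ) (.lab b ρ A)) : DD Φ (.lab b ρ A) :=
  fun Ψ hf hΨ => Deriv.baseLe (h1 Ψ hf hΨ) (h _ (hf.insert _) (Set.insert_subset_insert hΨ))

theorem split {b₁ b₂ C b ρ A} (h1 : DD Φ (.le b₁ b₂)) (h2 : DD Φ (.lab b₁ [] C))
    (h3 : DD (insert (.lab b₂ [] C) Φ) (.lab b ρ A))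
    (h4 : ∀ b', b' ≠ b₂ → DD (insert (.lt b₁ b') (insert (.le b' b₂) Φ)) (.lab b ρ A)) :
    DD Φ (.lab b ρ A) := by
  intro Ψ hf hΨ
  obtain ⟨x, hx, hfr⟩ := exists_fresh hf (b₁ :: b₂ :: b :: ρ)
  simp at hx
  refine Deriv.splitLe (h1 Ψ hf hΨ) (h2 Ψ hf hΨ) ?_
    (h4 x hx.2.1 _ ((hf.insert _).insert _)
      (Set.insert_subset_insert (Set.insert_subset_insert hΨ)))
    hx.1 hx.2.1 hx.2.2.1 hx.2.2.2 hfr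
  simpa [GenForm.subst] using h3 _ (hf.insert _) (Set.insert_subset_insert hΨ)

theorem ind {b₀ b ρ A} (h1 : DD Φ (.lab b₀ ρ A)) (h2 : DD Φ (.le b₀ b))
    (h : ∀ bi bj, DD (insert (.le b₀ bi) (insert (.lt bi bj) (insert (.lab bi ρ A) Φ)))
      (.lab bj ρ A)) : DD Φ (.lab b ρ A) := by
  intro Ψ hf hΨ
  obtain ⟨x, hx, hfr⟩ := exists_fresh hf (b :: b₀ :: ρ)
  obtain ⟨y, hy, hfr'⟩ := exists_fresh hf (x :: b :: b₀ :: ρ)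
  simp at hx hy
  exact Deriv.ind (h1 Ψ hf hΨ) (h2 Ψ hf hΨ)
    (h x y _ (((hf.insert _).insert _).insert _)
      (Set.insert_subset_insert (Set.insert_subset_insert (Set.insert_subset_insert hΨ))))
    (Ne.symm hy.1) hx.1 hx.2.1 hx.2.2 hfr hy.2.1 hy.2.2.1 hy.2.2.2 hfr'

/-! ### The axioms -/
variable {A B : NablaFormula P} {b : ℕ} {ρ : List ℕ}

theorem ax2 : DD Φ (.lab b ρ (.imp (.G (.imp A B)) (.imp (.G A) (.G B)))) := by
  refine impI (impI (GI fun c => ?_))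
  exact impE (A := A) (GE (b₁ := b) (assume (by simp)) (assume (by simp)))
    (GE (b₁ := b) (assume (by simp)) (assume (by simp)))

theorem ax4 : DD Φ (.lab b ρ (.imp (.X (.imp A B)) (.imp (.X A) (.X B)))) := by
  refine impI (impI (XI fun c => ?_))
  exact impE (A := A) (XE (b₁ := b) (assume (by simp)) (assume (by simp)))
    (XE (b₁ := b) (assume (by simp)) (assume (by simp)))

/-- `X A` from `A` at some successor. -/
theorem XI' {c} (hA : IsLocal A) (h1 : DD Φ (.lt b c)) (h2 : DD Φ (.lab c [] A)) :
    DD Φ (.lab b ρ (.X A)) := by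
  refine XI fun d => ?_
  exact linL (h1.mono (Set.subset_insert _ _)) (assume (by simp))
    (h2.mono (Set.subset_insert _ _)) hA

theorem ax3 (hA : IsLocal A) : DD Φ (.lab b ρ
    (NablaFormula.and (.imp (.X A.neg) (NablaFormula.X A).neg)
      (.imp (NablaFormula.X A).neg (.X A.neg)))) := by
  refine andI (impI ?_) (impI ?_)
  · refine negI (b' := b) (ρ' := ρ) (ser b fun c => ?_)
    refine exf (b₂ := c) (ρ₂ := b :: ρ) (negE (A := A) ?_ ?_)
    · exact XE (assume (by simp)) (assume (by simp))
    · exact XE (assume (by simp)) (assume (by simp))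
  · refine XI fun c => negI (b' := b) (ρ' := ρ) (negE (A := A.X) (assume (by simp)) ?_)
    exact XI' (c := c) hA (assume (by simp)) (last (ρ' := b :: ρ) (assume (by simp)) hA)

theorem isLocal_neg (h : IsLocal A) : IsLocal A.neg := .imp h .bot

theorem ax5 (hA : IsLocal A) :
    DD Φ (.lab b ρ (.imp (.G A) (NablaFormula.and A (.X (.G A))))) := by
  refine impI (andI ?_ ?_)
  · refine refl b (last (ρ' := b :: ρ) (GE (assume (by simp)) (assume (by simp))) hA)
  · refine XI fun c => GI fun d => ?_
    refine base (b₁ := b) (b₂ := c) (assume (by simp)) ?_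
    refine trans (b₁ := b) (b₂ := c) (b₃ := d) (assume (by simp)) (assume (by simp)) ?_
    exact last (ρ' := b :: ρ) (GE (assume (by simp)) (assume (by simp))) hA

theorem ax6 (hA : IsLocal A) :
    DD Φ (.lab b ρ (.imp (.G (.imp A (.X A))) (.imp A (.G A)))) := by
  refine impI (impI (GI fun c => last (ρ' := []) ?_ hA))
  refine ind (b₀ := b) (last (ρ' := ρ) (assume (by simp)) hA) (assume (by simp)) fun i j => ?_
  refine last (ρ' := i :: b :: ρ) (XE (impE (A := A) ?_ ?_) (assume (by simp))) hA
  · exact GE (assume (by simp)) (assume (by simp))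
  · exact last (ρ' := []) (assume (by simp)) hA

/-- The translation of until. -/
def UU (A B : NablaFormula P) : NablaFormula P :=
  NablaFormula.or B (NablaFormula.F (NablaFormula.and (.X B) (.nabla A)))

theorem isLocal_and_hist (h : IsHist A) (h' : IsHist B) : IsHist (A.and B) :=
  .imp (.imp (.imp (.imp h (.ofLocal .bot)) (.ofLocal .bot)) (.imp h' (.ofLocal .bot)))
    (.ofLocal .bot)

theorem isLocal_UU (hA : IsLocal A) (hB : IsLocal B) : IsLocal (UU A B) :=
  .imp (isLocal_neg hB) (isLocal_neg (.G (.imp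
    (isLocal_and_hist (.ofLocal (.X (.ofLocal hB))) (.nabla (.ofLocal hA))) (.ofLocal .bot))))

theorem ax8 (hB : IsLocal B) : DD Φ (.lab b ρ (.imp (UU A B) B.F)) := by
  refine impI (negI (b' := b) (ρ' := ρ) ?_)
  refine negE (A := .G (NablaFormula.and (.X B) (.nabla A)).neg)
    (impE (A := B.neg) (assume (φ := .lab b ρ (UU A B)) (by simp)) ?_) ?_
  · exact refl b (last (ρ' := b :: ρ) (GE (assume (by simp)) (assume (by simp)))
      (isLocal_neg hB))
  · refine GI fun c => negI (b' := c) (ρ' := b :: ρ) (ser c fun d => ?_)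
    refine base (b₁ := c) (b₂ := d) (assume (by simp)) ?_
    refine trans (b₁ := b) (b₂ := c) (b₃ := d) (assume (by simp)) (assume (by simp)) ?_
    refine exf (b₂ := d) (ρ₂ := b :: ρ) (negE (A := B) ?_ ?_)
    · exact GE (assume (by simp)) (assume (by simp))
    · refine last (ρ' := c :: b :: ρ) (XE (andE1 (B := .nabla A) ?_) (assume (by simp))) hB
      exact assume (by simp)

theorem ax7a (hA : IsLocal A) (hB : IsLocal B) :
    DD Φ (.lab b ρ (.imp (UU A B) (NablaFormula.or B (NablaFormula.and A (.X (UU A B)))))) := by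
  refine impI (impI (botE (b₂ := b) (ρ₂ := ρ) ?_))
  refine negE (A := .G (NablaFormula.and (.X B) (.nabla A)).neg)
    (impE (A := B.neg) (assume (φ := .lab b ρ (UU A B)) (by simp)) (assume (by simp))) ?_
  refine GI fun c => negI (b' := b) (ρ' := ρ)
    (negE (A := NablaFormula.and A (.X (UU A B))) (assume (by simp)) (andI ?_ ?_))
  · refine refl b (last (ρ' := b :: ρ) (nablaE (b₃ := c) ?_ (assume (by simp))
      (assume (by simp))) hA)
    exact andE2 (A := .X B) (assume (by simp))
  · refine XI fun d => impI (negI (b' := b) (ρ' := ρ) ?_)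
    refine split (b₁ := b) (b₂ := c) (C := (NablaFormula.X B).neg) (assume (by simp)) ?_ ?_ ?_
    · refine negI (b' := d) (ρ' := d :: b :: ρ) ?_
      refine exf (b₂ := d) (ρ₂ := b :: ρ) (negE (A := B) (assume (by simp)) ?_)
      exact last (ρ' := b :: []) (XE (assume (by simp)) (assume (by simp))) hB
    · refine exf (b₂ := c) (ρ₂ := []) (negE (A := .X B) (assume (by simp)) ?_)
      exact last (ρ' := b :: ρ) (andE1 (B := .nabla A) (assume (by simp))) (.X (.ofLocal hB))
    · intro b' hb'
      refine linLe (b₁ := b) (b₂ := b') (b₃ := d) (c := c) (assume (by simp)) (assume (by simp))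
        (assume (by simp)) hb' ?_
      refine exf (b₂ := c) (ρ₂ := d :: b :: ρ)
        (negE (A := NablaFormula.and (.X B) (.nabla A)) ?_ (andI ?_ ?_))
      · exact GE (assume (by simp)) (assume (by simp))
      · exact last (ρ' := b :: ρ) (andE1 (B := .nabla A) (assume (by simp))) (.X (.ofLocal hB))
      · refine nablaI fun e => ?_
        refine base (b₁ := b) (b₂ := d) (assume (by simp)) ?_
        refine trans (b₁ := b) (b₂ := d) (b₃ := e) (assume (by simp)) (assume (by simp)) ?_
        refine last (ρ' := b :: ρ) (nablaE (b₃ := c) ?_ (assume (by simp)) (assume (by simp))) hA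
        exact andE2 (A := .X B) (assume (by simp))

theorem ax7b (hA : IsLocal A) (hB : IsLocal B) :
    DD Φ (.lab b ρ (.imp (NablaFormula.or B (NablaFormula.and A (.X (UU A B)))) (UU A B))) := by
  refine impI (impI (negI (b' := b) (ρ' := ρ) ?_))
  refine cut (φ := .lab b ρ (NablaFormula.and A (.X (UU A B))))
    ?_ (impE (A := B.neg) (assume (φ := .lab b ρ (NablaFormula.or B _)) (by simp)) (assume (by simp)))
  refine ser b fun d => ?_
  refine exf (b₂ := d) (ρ₂ := b :: ρ) ?_
  refine negE (A := .G (NablaFormula.and (.X B) (.nabla A)).neg)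
    (impE (A := B.neg) (XE (A := UU A B) (andE2 (A := A) (assume (by simp))) (assume (by simp)))
      ?_) ?_
  · refine negI (b' := b) (ρ' := b :: ρ) ?_
    refine negE (A := NablaFormula.and (.X B) (.nabla A)) ?_ (andI ?_ ?_)
    · exact refl b (GE (assume (by simp)) (assume (by simp)))
    · exact XI' (c := d) hB (assume (by simp)) (last (ρ' := b :: ρ) (assume (by simp)) hB)
    · refine nablaI fun e => ?_
      refine eqLe (b₁ := b) (assume (by simp)) (assume (by simp)) ?_
      exact last (ρ' := ρ) (andE1 (B := .X (UU A B)) (assume (by simp))) hA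
  · refine GI fun c => negI (b' := c) (ρ' := b :: ρ) ?_
    refine negE (A := NablaFormula.and (.X B) (.nabla A)) ?_ (andI ?_ ?_)
    · refine base (b₁ := b) (b₂ := d) (assume (by simp)) ?_
      refine trans (b₁ := b) (b₂ := d) (b₃ := c) (assume (by simp)) (assume (by simp)) ?_
      exact GE (assume (by simp)) (assume (by simp))
    · exact last (ρ' := d :: b :: ρ) (andE1 (B := .nabla A) (assume (by simp))) (.X (.ofLocal hB))
    · refine nablaI fun e => ?_
      refine split (b₁ := b) (b₂ := e) (C := A) (assume (by simp)) ?_ ?_ ?_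
      · exact last (ρ' := ρ) (andE1 (B := .X (UU A B)) (assume (by simp))) hA
      · exact last (ρ' := []) (assume (by simp)) hA
      · intro b' hb'
        refine linLe (b₁ := b) (b₂ := b') (b₃ := d) (c := e) (assume (by simp))
          (assume (by simp)) (assume (by simp)) hb' ?_
        refine last (ρ' := d :: b :: ρ) (nablaE (b₃ := c) ?_ (assume (by simp))
          (assume (by simp))) hA
        exact andE2 (A := .X B) (assume (by simp))

end DD

theorem isLocal_tr {P : Type} (A : LTLFormula P) : IsLocal (trNabla A) := by
  induction A with
  | atom p => exact .atom p
  | bot => exact .bot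
  | imp A B hA hB => exact .imp hA hB
  | G A hA => exact .G (.ofLocal hA)
  | X A hA => exact .X (.ofLocal hA)
  | U A B hA hB => exact DD.isLocal_UU hA hB

/-! ### Tautologies -/
section Taut
variable {P : Type}

/-- The prime constituents of a formula. -/
def primes : LTLFormula P → List (LTLFormula P)
  | .bot => []
  | .imp A B => primes A ++ primes B
  | A => [A]

open Classical in
/-- The literals over `L` made true by `v`. -/
noncomputable def lits (b : ℕ) (ρ : List ℕ) (v : LTLFormula P → Prop) (L : List (LTLFormula P)) :
    Set (GenForm P) :=
  {φ | ∃ q ∈ L, φ = .lab b ρ (if v q then trNabla q else (trNabla q).neg)}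

theorem kalmar (b : ℕ) (ρ : List ℕ) (v : LTLFormula P → Prop) (A : LTLFormula P) :
    (propEval v A → DD (lits b ρ v (primes A)) (.lab b ρ (trNabla A))) ∧
    (¬ propEval v A → DD (lits b ρ v (primes A)) (.lab b ρ (trNabla A).neg)) := by
  have prime : ∀ q : LTLFormula P, primes q = [q] → (propEval v q ↔ v q) →
    (propEval v q → DD (lits b ρ v (primes q)) (.lab b ρ (trNabla q))) ∧
    (¬ propEval v q → DD (lits b ρ v (primes q)) (.lab b ρ (trNabla q).neg)) := by
    intro q hq hv
    rw [hq, hv]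
    refine ⟨fun h => DD.assume ⟨q, by simp, by simp [h]⟩,
      fun h => DD.assume ⟨q, by simp, by simp [h]⟩⟩
  induction A with
  | atom p => exact prime _ rfl Iff.rfl
  | G A _ => exact prime _ rfl Iff.rfl
  | X A _ => exact prime _ rfl Iff.rfl
  | U A B _ _ => exact prime _ rfl Iff.rfl
  | bot => exact ⟨fun h => h.elim, fun _ => DD.impI (DD.assume (by simp [trNabla]))⟩
  | imp A B hA hB =>
    have sA : lits b ρ v (primes A) ⊆ lits b ρ v (primes (.imp A B)) := by
      rintro φ ⟨q, hq, rfl⟩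
      exact ⟨q, by simp [primes, hq], rfl⟩
    have sB : lits b ρ v (primes B) ⊆ lits b ρ v (primes (.imp A B)) := by
      rintro φ ⟨q, hq, rfl⟩
      exact ⟨q, by simp [primes, hq], rfl⟩
    constructor
    · intro h
      refine DD.impI ?_
      by_cases ha : propEval v A
      · exact (hB.1 (h ha)).mono (sB.trans (Set.subset_insert _ _))
      · refine DD.exf (b₂ := b) (ρ₂ := ρ) (DD.negE ((hA.2 ha).mono
          (sA.trans (Set.subset_insert _ _))) (DD.assume (by simp)))
    · intro h
      have h' : propEval v A ∧ ¬ propEval v B := by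
        simpa [propEval] using h
      refine DD.negI (b' := b) (ρ' := ρ) (DD.negE ((hB.2 h'.2).mono
          (sB.trans (Set.subset_insert _ _))) ?_)
      exact DD.impE (DD.assume (Set.mem_insert _ _))
        ((hA.1 h'.1).mono (sA.trans (Set.subset_insert _ _)))

theorem lits_elim (b : ℕ) (ρ : List ℕ) (C : NablaFormula P) (L : List (LTLFormula P)) :
    (∀ v, DD (lits b ρ v L) (.lab b ρ C)) → DD ∅ (.lab b ρ C) := by
  classical
  induction L with
  | nil =>
    intro h
    refine (h fun _ => True).mono ?_
    rintro φ ⟨q, hq, -⟩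
    simp at hq
  | cons q L ih =>
    intro h
    refine ih fun v => ?_
    refine DD.byCases (b := b) (ρ := ρ) (A := trNabla q) ?_ ?_
    · refine (h (Function.update v q True)).mono ?_
      rintro φ ⟨r, hr, rfl⟩
      by_cases hrq : r = q
      · subst hrq; simp
      · refine Or.inr ⟨r, by simpa [hrq] using hr, by simp [hrq]⟩
    · refine (h (Function.update v q False)).mono ?_
      rintro φ ⟨r, hr, rfl⟩
      by_cases hrq : r = q
      · subst hrq; simp
      · refine Or.inr ⟨r, by simpa [hrq] using hr, by simp [hrq]⟩

end Taut

theorem hltl_dd {P : Type} {A : LTLFormula P} (h : HLTL A) :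
    ∀ b ρ, DD ∅ (.lab b ρ (trNabla A)) := by
  induction h with
  | taut h => exact fun b ρ => lits_elim b ρ _ _ fun v => (kalmar b ρ v _).1 (h v)
  | a2 => exact fun b ρ => DD.ax2
  | a3 => exact fun b ρ => DD.ax3 (isLocal_tr _)
  | a4 => exact fun b ρ => DD.ax4
  | a5 => exact fun b ρ => DD.ax5 (isLocal_tr _)
  | a6 => exact fun b ρ => DD.ax6 (isLocal_tr _)
  | a7 => exact fun b ρ => DD.andI (DD.ax7a (isLocal_tr _) (isLocal_tr _))
            (DD.ax7b (isLocal_tr _) (isLocal_tr _))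
  | a8 => exact fun b ρ => DD.ax8 (isLocal_tr _)
  | mp _ _ h1 h2 => exact fun b ρ => DD.impE (h1 b ρ) (h2 b ρ)
  | necX _ h => exact fun b ρ => DD.XI fun c => (h _ _).mono (Set.empty_subset _)
  | necG _ h => exact fun b ρ => DD.GI fun c => (h _ _).mono (Set.empty_subset _)

/-! ## Part 2: completeness of H(LTL) -/

section Completeness
variable {P : Type}

/-- Provability from hypotheses by modus ponens. -/
inductive Prf (Γ : Set (LTLFormula P)) : LTLFormula P → Prop
  | ax {A} : HLTL A → Prf Γ A
  | hyp {A} : A ∈ Γ → Prf Γ A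
  | mp {A B} : Prf Γ (.imp A B) → Prf Γ A → Prf Γ B

theorem Prf.mono {Γ Δ : Set (LTLFormula P)} (hs : Γ ⊆ Δ) {A} (h : Prf Γ A) : Prf Δ A := by
  induction h with
  | ax h => exact .ax h
  | hyp h => exact .hyp (hs h)
  | mp _ _ h1 h2 => exact .mp h1 h2

theorem Prf.ded {Γ : Set (LTLFormula P)} {A B} (h : Prf (insert A Γ) B) : Prf Γ (.imp A B) := by
  induction h with
  | @ax C h => exact .mp (.ax (.taut fun v => by simp [propEval]; tauto)) (.ax h)
  | @hyp C h =>
    rcases h with rfl | h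
    · exact .ax (.taut fun v => by simp [propEval])
    · exact .mp (.ax (.taut fun v => by simp [propEval]; tauto)) (.hyp h)
  | @mp C D _ _ h1 h2 =>
    exact .mp (.mp (.ax (.taut fun v => by simp only [propEval]; tauto)) h1) h2

theorem Prf.empty {A : LTLFormula P} (h : Prf ∅ A) : HLTL A := by
  induction h with
  | ax h => exact h
  | hyp h => exact h.elim
  | mp _ _ h1 h2 => exact .mp h1 h2

theorem Prf.chain {c : Set (Set (LTLFormula P))} (hc : IsChain (· ⊆ ·) c) (hne : c.Nonempty)
    {A} (h : Prf (⋃₀ c) A) : ∃ Γ ∈ c, Prf Γ A := by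
  induction h with
  | ax h => exact ⟨_, hne.some_mem, .ax h⟩
  | hyp h => obtain ⟨Γ, h1, h2⟩ := h; exact ⟨Γ, h1, .hyp h2⟩
  | mp _ _ h1 h2 =>
    obtain ⟨Γ, g1, g2⟩ := h1
    obtain ⟨Δ, d1, d2⟩ := h2
    rcases hc.total g1 d1 with hs | hs
    · exact ⟨Δ, d1, .mp (g2.mono hs) d2⟩
    · exact ⟨Γ, g1, .mp g2 (d2.mono hs)⟩

/-- Maximal consistent sets, as worlds. -/
structure World (P : Type) where
  s : Set (LTLFormula P)
  thm : ∀ {A}, HLTL A → A ∈ s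
  bot : LTLFormula.bot ∉ s
  imp : ∀ {A B}, LTLFormula.imp A B ∈ s ↔ (A ∈ s → B ∈ s)

theorem lindenbaum {A : LTLFormula P} (hA : ¬ HLTL A) : ∃ w : World P, A ∉ w.s := by
  have h0 : ¬ Prf ({A.neg} : Set (LTLFormula P)) .bot := by
    intro h
    have h1 : Prf (insert A.neg (∅ : Set (LTLFormula P))) .bot := by simpa using h
    exact hA (.mp (.taut fun v => by simp [propEval, LTLFormula.neg]) h1.ded.empty)
  obtain ⟨M, hM0, hM⟩ := zorn_subset_nonempty {Γ : Set (LTLFormula P) | ¬ Prf Γ .bot}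
    (fun c hc hch hne => ⟨⋃₀ c, fun h => by
      obtain ⟨Γ, g1, g2⟩ := Prf.chain hch hne h
      exact hc g1 g2, fun s hs => Set.subset_sUnion_of_mem hs⟩) _ h0
  have hcons : ¬ Prf M .bot := hM.prop
  have hneg : ∀ B, B ∉ M → Prf M B.neg := by
    intro B hB
    by_contra hn
    have : ¬ Prf (insert B M) .bot := fun h => hn h.ded
    exact hB (hM.le_of_ge this (Set.subset_insert _ _) (Set.mem_insert _ _))
  have hcl : ∀ {B}, Prf M B → B ∈ M := by
    intro B hB
    by_contra hn
    exact hcons (.mp (hneg B hn) hB)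
  refine ⟨⟨M, fun h => hcl (.ax h), fun h => hcons (.hyp h), ?_⟩, ?_⟩
  · intro B C
    refine ⟨fun h hb => hcl (.mp (.hyp h) (.hyp hb)), fun h => ?_⟩
    by_cases hb : B ∈ M
    · exact hcl (.mp (.ax (.taut fun v => by simp [propEval]; tauto)) (.hyp (h hb)))
    · refine hcl (.mp (.ax (.taut fun v => ?_)) (hneg B hb))
      simp only [propEval, LTLFormula.neg]; tauto
  · intro h
    exact hcons (.mp (.hyp (hM0 rfl)) (.hyp h))

namespace World
variable (w : World P) {A B : LTLFormula P}

theorem neg : A.neg ∈ w.s ↔ A ∉ w.s := by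
  simp [LTLFormula.neg, w.imp, w.bot]

theorem or : A.or B ∈ w.s ↔ (A ∈ w.s ∨ B ∈ w.s) := by
  simp only [LTLFormula.or, w.imp, w.neg]; tauto

theorem and : A.and B ∈ w.s ↔ (A ∈ w.s ∧ B ∈ w.s) := by
  simp only [LTLFormula.and, w.or, w.neg]; tauto

theorem iff : A.iff B ∈ w.s ↔ (A ∈ w.s ↔ B ∈ w.s) := by
  simp only [LTLFormula.iff, w.and, w.imp]; tauto

theorem X_neg : (A.neg).X ∈ w.s ↔ A.X ∉ w.s := by
  have := w.iff.1 (w.thm (HLTL.a3 (A := A)))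
  rw [this, w.neg]

/-- The next world. -/
def next : World P where
  s := {A | A.X ∈ w.s}
  thm h := w.thm (.necX h)
  bot := by
    change LTLFormula.X .bot ∉ w.s
    rw [← w.X_neg]
    exact w.thm (.necX (.taut fun v => by simp [propEval, LTLFormula.neg]))
  imp := by
    intro A B
    change LTLFormula.X (.imp A B) ∈ w.s ↔ (A.X ∈ w.s → B.X ∈ w.s)
    have k : ∀ C D : LTLFormula P, HLTL (.imp C D) → C.X ∈ w.s → D.X ∈ w.s := fun C D h hc =>
      w.imp.1 (w.imp.1 (w.thm .a4) (w.thm (.necX h))) hc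
    refine ⟨fun h => w.imp.1 (w.imp.1 (w.thm .a4) h), fun h => ?_⟩
    by_cases ha : A.X ∈ w.s
    · exact k _ _ (.taut fun v => by simp only [propEval]; tauto) (h ha)
    · exact k A.neg _ (.taut fun v => by simp only [propEval, LTLFormula.neg]; tauto)
        (w.X_neg.2 ha)

theorem mem_next : A ∈ w.next.s ↔ A.X ∈ w.s := Iff.rfl

end World

theorem prov_of_worlds {A : LTLFormula P} (h : ∀ w : World P, A ∈ w.s) : HLTL A := by
  by_contra hn
  obtain ⟨w, hw⟩ := lindenbaum hn
  exact hw (h w)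

theorem World.G_mono (w : World P) {A B : LTLFormula P} (h : ∀ u : World P, A ∈ u.s → B ∈ u.s)
    (hA : A.G ∈ w.s) : B.G ∈ w.s :=
  w.imp.1 (w.imp.1 (w.thm .a2) (w.thm (.necG (prov_of_worlds fun u => u.imp.2 (h u))))) hA

theorem World.G_ind (w : World P) {A : LTLFormula P} (h : ∀ u : World P, A ∈ u.s → A ∈ u.next.s)
    (hA : A ∈ w.s) : A.G ∈ w.s :=
  w.imp.1 (w.imp.1 (w.thm .a6) (w.thm (.necG (prov_of_worlds fun u => u.imp.2 (h u))))) hA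

theorem World.G_iff (w : World P) {A : LTLFormula P} :
    A.G ∈ w.s ↔ (A ∈ w.s ∧ A.G ∈ w.next.s) := by
  have h5 : ∀ u : World P, A.G ∈ u.s → (A ∈ u.s ∧ A.G ∈ u.next.s) := fun u h =>
    u.and.1 (u.imp.1 (u.thm .a5) h)
  refine ⟨h5 w, fun h => ?_⟩
  refine w.G_mono (A := A.and A.G.X) (fun u hu => (u.and.1 hu).1) (w.G_ind ?_ (w.and.2 h))
  exact fun u hu => (World.and _).2 (h5 _ (u.and.1 hu).2)

theorem World.U_iff (w : World P) {A B : LTLFormula P} :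
    A.U B ∈ w.s ↔ (B ∈ w.s ∨ (A ∈ w.s ∧ A.U B ∈ w.next.s)) := by
  rw [w.iff.1 (w.thm .a7), w.or, w.and, w.mem_next]

/-- Agreement of two worlds on a list of formulas. -/
def Agree (L : List (LTLFormula P)) (u w : World P) : Prop := ∀ C ∈ L, C ∈ u.s ↔ C ∈ w.s

theorem definable (L : List (LTLFormula P)) : ∀ Z : World P → Prop,
    (∀ u w, Agree L u w → Z u → Z w) → ∃ χ : LTLFormula P, ∀ u : World P, χ ∈ u.s ↔ Z u := by
  induction L with
  | nil =>
    intro Z hZ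
    by_cases h : ∃ u, Z u
    · obtain ⟨u, hu⟩ := h
      refine ⟨.neg .bot, fun w => ?_⟩
      have : Z w := hZ u w (by simp [Agree]) hu
      simp [w.neg, w.bot, this]
    · push Not at h
      exact ⟨.bot, fun w => by simp [w.bot, h w]⟩
  | cons q L ih =>
    intro Z hZ
    obtain ⟨χ1, h1⟩ := ih (fun u => ∃ z, Z z ∧ Agree L z u ∧ q ∈ z.s) (by
      rintro u w huw ⟨z, a, b, c⟩
      exact ⟨z, a, fun C hC => (b C hC).trans (huw C hC), c⟩)
    obtain ⟨χ0, h0⟩ := ih (fun u => ∃ z, Z z ∧ Agree L z u ∧ q ∉ z.s) (by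
      rintro u w huw ⟨z, a, b, c⟩
      exact ⟨z, a, fun C hC => (b C hC).trans (huw C hC), c⟩)
    refine ⟨(q.and χ1).or (q.neg.and χ0), fun u => ?_⟩
    rw [u.or, u.and, u.and, u.neg, h1, h0]
    constructor
    · rintro (⟨hq, z, a, b, c⟩ | ⟨hq, z, a, b, c⟩)
      · refine hZ z u (fun C hC => ?_) a
        rcases List.mem_cons.1 hC with rfl | hC
        · simp [hq, c]
        · exact b C hC
      · refine hZ z u (fun C hC => ?_) a
        rcases List.mem_cons.1 hC with rfl | hC
        · simp [hq, c]
        · exact b C hC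
    · intro hu
      by_cases hq : q ∈ u.s
      · exact .inl ⟨hq, u, hu, fun _ _ => Iff.rfl, hq⟩
      · exact .inr ⟨hq, u, hu, fun _ _ => Iff.rfl, hq⟩

/-- Filtrated successor relation. -/
def StepRel (L : List (LTLFormula P)) (w w' : World P) : Prop :=
  ∃ u, Agree L w u ∧ Agree L u.next w'

theorem reach (L : List (LTLFormula P)) (w : World P) (T : LTLFormula P)
    (hL : T ∈ L) (b : Prop)
    (h : ∀ z, Relation.ReflTransGen (StepRel L) w z → (T ∈ z.s ↔ b)) :
    ∃ χ : LTLFormula P, χ.G ∈ w.s ∧ ∀ u : World P, χ ∈ u.s → (T ∈ u.s ↔ b) := by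
  obtain ⟨χ, hχ⟩ := definable L
    (fun u => ∃ z, Relation.ReflTransGen (StepRel L) w z ∧ Agree L z u) (by
      rintro u v huv ⟨z, a, b⟩
      exact ⟨z, a, fun C hC => (b C hC).trans (huv C hC)⟩)
  refine ⟨χ, w.G_ind (fun u hu => ?_) ((hχ w).2 ⟨w, .refl, fun _ _ => Iff.rfl⟩), fun u hu => ?_⟩
  · obtain ⟨z, a, b⟩ := (hχ u).1 hu
    exact (hχ _).2 ⟨u.next, a.tail ⟨u, b, fun _ _ => Iff.rfl⟩, fun _ _ => Iff.rfl⟩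
  · obtain ⟨z, a, b⟩ := (hχ u).1 hu
    rw [← b T hL]
    exact h z a

end Completeness

/-! ### Fair paths -/
section Fair

/-- Reachability of `F` in at most `n` steps. -/
def Within {T : Type*} (R : T → T → Prop) (F : T → Prop) : ℕ → T → Prop
  | 0, t => F t
  | n + 1, t => F t ∨ ∃ s, R t s ∧ Within R F n s

theorem within_of_reach {T : Type*} {R : T → T → Prop} {F : T → Prop} {t s : T}
    (h : Relation.ReflTransGen R t s) (hs : F s) : ∃ n, Within R F n t := by
  induction h using Relation.ReflTransGen.head_induction_on with
  | refl => exact ⟨0, hs⟩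
  | head hab _ ih => obtain ⟨n, hn⟩ := ih; exact ⟨n + 1, Or.inr ⟨_, hab, hn⟩⟩

theorem fair {T : Type*} (R : T → T → Prop) (ser : ∀ t, ∃ s, R t s)
    (pend ful : ℕ → T → Prop)
    (pers : ∀ e t s, pend e t → ¬ ful e t → R t s → pend e s)
    (rch : ∀ e t, pend e t → ∃ s, Relation.ReflTransGen R t s ∧ ful e s) (t0 : T) :
    ∃ f : ℕ → T, f 0 = t0 ∧ (∀ n, R (f n) (f (n + 1))) ∧
      ∀ e i, pend e (f i) → ∃ j, i ≤ j ∧ ful e (f j) := by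
  classical
  -- one step of the scheduler
  have step : ∀ x : T × ℕ, ∃ y : T × ℕ, R x.1 y.1 ∧
      ((¬ (pend x.2.unpair.1 x.1 ∧ ¬ ful x.2.unpair.1 x.1) ∧ y.2 = x.2 + 1) ∨
       (pend x.2.unpair.1 x.1 ∧ y.2 = x.2 ∧ ∀ n, Within R (ful x.2.unpair.1) (n + 1) x.1 →
         ¬ ful x.2.unpair.1 x.1 ∧ Within R (ful x.2.unpair.1) n y.1)) := by
    rintro ⟨t, k⟩
    by_cases h : pend k.unpair.1 t ∧ ¬ ful k.unpair.1 t
    · obtain ⟨s, hs, hf⟩ := rch _ _ h.1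
      have hex := within_of_reach (F := ful k.unpair.1) hs hf
      -- minimal distance
      have hmin := Nat.find_spec hex
      have hle : ∀ n, Within R (ful k.unpair.1) n t → Nat.find hex ≤ n :=
        fun n hn => Nat.find_min' hex hn
      generalize Nat.find hex = d at hmin hle
      cases d with
      | zero => exact (h.2 hmin).elim
      | succ d =>
        rcases hmin with hmin | ⟨s', hs', hw⟩
        · exact (h.2 hmin).elim
        · refine ⟨(s', k), hs', Or.inr ⟨h.1, rfl, fun n hn => ⟨h.2, ?_⟩⟩⟩
          have : d ≤ n := by have := hle _ hn; omega
          clear hn hle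
          have mono : ∀ m t, Within R (ful k.unpair.1) m t → Within R (ful k.unpair.1) (m+1) t := by
            intro m
            induction m with
            | zero => exact fun t h => Or.inl h
            | succ m ih =>
              rintro t (h | ⟨s, h1, h2⟩)
              · exact Or.inl h
              · exact Or.inr ⟨s, h1, ih _ h2⟩
          exact Nat.le_induction hw (fun m _ hm => mono m _ hm) n this
    · obtain ⟨s, hs⟩ := ser t
      exact ⟨(s, k + 1), hs, Or.inl ⟨h, rfl⟩⟩
  choose nx hR hnx using step
  let g : ℕ → T × ℕ := fun n => Nat.rec (t0, 0) (fun _ x => nx x) n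
  have hg : ∀ n, g (n + 1) = nx (g n) := fun n => rfl
  refine ⟨fun n => (g n).1, rfl, fun n => by simpa only [hg] using hR (g n), fun e i hp => ?_⟩
  by_contra hcon
  push Not at hcon
  have hpend : ∀ j, i ≤ j → pend e (g j).1 := by
    intro j hj
    induction j, hj using Nat.le_induction with
    | base => exact hp
    | succ j hj ih => exact pers e _ _ ih (hcon j hj) (by simpa only [hg] using hR (g j))
  let good : ℕ → Prop := fun j =>
    ¬ (pend (g j).2.unpair.1 (g j).1 ∧ ¬ ful (g j).2.unpair.1 (g j).1) ∧ (g (j + 1)).2 = (g j).2 + 1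
  have key : ∀ n j, Within R (ful (g j).2.unpair.1) n (g j).1 →
      ∃ l, j ≤ l ∧ (g l).2 = (g j).2 ∧ good l := by
    intro n
    induction n with
    | zero =>
      intro j hw
      rcases hnx (g j) with h | ⟨_, _, h⟩
      · exact ⟨j, le_rfl, rfl, by simpa only [good, hg] using h⟩
      · exact absurd hw (h 0 (Or.inl hw)).1
    | succ n ih =>
      intro j hw
      rcases hnx (g j) with h | ⟨_, h1, h⟩
      · exact ⟨j, le_rfl, rfl, by simpa only [good, hg] using h⟩
      · have := (h n hw).2
        rw [← hg] at this h1
        rw [← h1] at this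
        obtain ⟨l, l1, l2, l3⟩ := ih (j + 1) this
        exact ⟨l, by omega, l2.trans h1, l3⟩
  have key' : ∀ j, ∃ l, j ≤ l ∧ (g l).2 = (g j).2 ∧ good l := by
    intro j
    by_cases h : pend (g j).2.unpair.1 (g j).1
    · obtain ⟨s, hs, hf⟩ := rch _ _ h
      obtain ⟨n, hn⟩ := within_of_reach (F := ful (g j).2.unpair.1) hs hf
      exact key n j hn
    · rcases hnx (g j) with h' | ⟨h1, -⟩
      · exact ⟨j, le_rfl, rfl, by simpa only [good, hg] using h'⟩
      · exact absurd h1 h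
  have all : ∀ m, (g i).2 ≤ m → ∃ l, i ≤ l ∧ (g l).2 = m ∧ good l := by
    intro m hm
    induction m, hm using Nat.le_induction with
    | base => exact key' i
    | succ m hm ih =>
      obtain ⟨l, l1, l2, l3⟩ := ih
      obtain ⟨l', k1, k2, k3⟩ := key' (l + 1)
      exact ⟨l', by omega, by rw [k2, l3.2, l2], k3⟩
  obtain ⟨l, l1, l2, l3⟩ := all (Nat.pair e (g i).2) (Nat.right_le_pair _ _)
  have := l3.1
  rw [l2] at this
  simp only [Nat.unpair_pair] at this
  exact this ⟨hpend l l1, hcon l l1⟩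

end Fair

section Main
variable {P : Type}

/-- Subformulas. -/
def subf : LTLFormula P → List (LTLFormula P)
  | .atom p => [.atom p]
  | .bot => [.bot]
  | .imp A B => .imp A B :: (subf A ++ subf B)
  | .G A => .G A :: subf A
  | .X A => .X A :: subf A
  | .U A B => .U A B :: (subf A ++ subf B)

theorem self_subf (A : LTLFormula P) : A ∈ subf A := by cases A <;> simp [subf]

theorem subf_trans {A C : LTLFormula P} (h : C ∈ subf A) : subf C ⊆ subf A := by
  induction A with
  | atom p => simp [subf] at h; subst h; simp
  | bot => simp [subf] at h; subst h; simp
  | imp A B hA hB =>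
    simp only [subf, List.mem_cons, List.mem_append] at h
    rcases h with rfl | h | h
    · simp
    · intro x hx; simp [subf, hA h hx]
    · intro x hx; simp [subf, hB h hx]
  | G A hA =>
    simp only [subf, List.mem_cons] at h
    rcases h with rfl | h
    · simp
    · intro x hx; simp [subf, hA h hx]
  | X A hA =>
    simp only [subf, List.mem_cons] at h
    rcases h with rfl | h
    · simp
    · intro x hx; simp [subf, hA h hx]
  | U A B hA hB =>
    simp only [subf, List.mem_cons, List.mem_append] at h
    rcases h with rfl | h | h
    · simp
    · intro x hx; simp [subf, hA h hx]
    · intro x hx; simp [subf, hB h hx]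

/-- Pending eventualities. -/
def Pend : LTLFormula P → World P → Prop
  | .U A B, w => A.U B ∈ w.s
  | .G A, w => A.G ∉ w.s
  | _, _ => False

/-- Fulfilled eventualities. -/
def Ful : LTLFormula P → World P → Prop
  | .U _ B, w => B ∈ w.s
  | .G A, w => A ∉ w.s
  | _, _ => False

theorem subf_U {A₀ A B : LTLFormula P} (h : A.U B ∈ subf A₀) : A ∈ subf A₀ ∧ B ∈ subf A₀ :=
  ⟨subf_trans h (by simp [subf, self_subf]), subf_trans h (by simp [subf, self_subf])⟩

theorem subf_imp {A₀ A B : LTLFormula P} (h : A.imp B ∈ subf A₀) : A ∈ subf A₀ ∧ B ∈ subf A₀ :=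
  ⟨subf_trans h (by simp [subf, self_subf]), subf_trans h (by simp [subf, self_subf])⟩

theorem subf_G {A₀ A : LTLFormula P} (h : A.G ∈ subf A₀) : A ∈ subf A₀ :=
  subf_trans h (by simp [subf, self_subf])

theorem subf_X {A₀ A : LTLFormula P} (h : A.X ∈ subf A₀) : A ∈ subf A₀ :=
  subf_trans h (by simp [subf, self_subf])

theorem rel_G {A₀ A : LTLFormula P} (h : A.G ∈ subf A₀) {w w' : World P}
    (hR : StepRel (subf A₀) w w') : A.G ∈ w.s ↔ (A ∈ w.s ∧ A.G ∈ w'.s) := by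
  obtain ⟨u, h1, h2⟩ := hR
  rw [h1 _ h, h1 _ (subf_G h), ← h2 _ h, u.G_iff]

theorem rel_U {A₀ A B : LTLFormula P} (h : A.U B ∈ subf A₀) {w w' : World P}
    (hR : StepRel (subf A₀) w w') : A.U B ∈ w.s ↔ (B ∈ w.s ∨ (A ∈ w.s ∧ A.U B ∈ w'.s)) := by
  obtain ⟨u, h1, h2⟩ := hR
  rw [h1 _ h, h1 _ (subf_U h).1, h1 _ (subf_U h).2, ← h2 _ h, u.U_iff]

theorem rel_X {A₀ A : LTLFormula P} (h : A.X ∈ subf A₀) {w w' : World P}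
    (hR : StepRel (subf A₀) w w') : A.X ∈ w.s ↔ A ∈ w'.s := by
  obtain ⟨u, h1, h2⟩ := hR
  rw [h1 _ h, ← h2 _ (subf_X h), u.mem_next]

theorem pend_pers {A₀ e : LTLFormula P} (h : e ∈ subf A₀) {w w' : World P}
    (hp : Pend e w) (hf : ¬ Ful e w) (hR : StepRel (subf A₀) w w') : Pend e w' := by
  cases e with
  | U A B =>
    have := rel_U h hR
    simp only [Pend, Ful] at *
    tauto
  | G A =>
    have := rel_G h hR
    simp only [Pend, Ful] at *
    tauto
  | _ => exact hp.elim

theorem pend_reach {A₀ e : LTLFormula P} (h : e ∈ subf A₀) {w : World P}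
    (hp : Pend e w) : ∃ z, Relation.ReflTransGen (StepRel (subf A₀)) w z ∧ Ful e z := by
  by_contra hcon
  push Not at hcon
  cases e with
  | U A B =>
    obtain ⟨χ, h1, h2⟩ := reach (subf A₀) w B (subf_U h).2 False
      (fun z hz => by simpa [Ful] using hcon z hz)
    have h3 : B.neg.G ∈ w.s := w.G_mono (fun u hu => u.neg.2 (by simpa using h2 u hu)) h1
    have h4 : B.F ∈ w.s := w.imp.1 (w.thm .a8) hp
    exact w.neg.1 h4 h3
  | G A =>
    obtain ⟨χ, h1, h2⟩ := reach (subf A₀) w A (subf_G h) True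
      (fun z hz => by simpa [Ful] using hcon z hz)
    exact hp (w.G_mono (fun u hu => by simpa using h2 u hu) h1)
  | _ => exact hp.elim

theorem truth {A₀ : LTLFormula P} (f : ℕ → World P) (hR : ∀ n, StepRel (subf A₀) (f n) (f (n + 1)))
    (hf : ∀ e ∈ subf A₀, ∀ i, Pend e (f i) → ∃ j, i ≤ j ∧ Ful e (f j)) (C : LTLFormula P) :
    C ∈ subf A₀ → ∀ n, LTLSat (fun n p => LTLFormula.atom p ∈ (f n).s) C n ↔ C ∈ (f n).s := by
  induction C with
  | atom p => exact fun _ n => Iff.rfl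
  | bot => exact fun _ n => by simp [LTLSat, (f n).bot]
  | imp A B hA hB =>
    intro h n
    rw [LTLSat, hA (subf_imp h).1, hB (subf_imp h).2, (f n).imp]
  | X A hA =>
    intro h n
    rw [LTLSat, hA (subf_X h), rel_X h (hR n)]
  | G A hA =>
    intro h n
    simp only [LTLSat, hA (subf_G h)]
    constructor
    · intro hall
      by_contra hn
      obtain ⟨j, hj, hj'⟩ := hf _ h n hn
      exact hj' (hall j hj)
    · intro hn m hm
      have : A.G ∈ (f m).s := by
        induction m, hm using Nat.le_induction with
        | base => exact hn
        | succ m hm ih => exact ((rel_G h (hR m)).1 ih).2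
      exact ((rel_G h (hR m)).1 this).1
  | U A B hA hB =>
    intro h n
    simp only [LTLSat, hA (subf_U h).1, hB (subf_U h).2]
    constructor
    · rintro ⟨n', hn, hb, ha⟩
      have : ∀ k m, m + k = n' → n ≤ m → A.U B ∈ (f m).s := by
        intro k
        induction k with
        | zero =>
          intro m hm _
          obtain rfl : m = n' := by omega
          exact (rel_U h (hR m)).2 (Or.inl hb)
        | succ k ih =>
          intro m hm hnm
          exact (rel_U h (hR m)).2 (Or.inr ⟨ha m hnm (by omega), ih (m + 1) (by omega) (by omega)⟩)
      exact this (n' - n) n (by omega) le_rfl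
    · intro hn
      classical
      have hex := hf _ h n hn
      have hs := Nat.find_spec hex
      have hmin : ∀ m, n ≤ m → m < Nat.find hex → B ∉ (f m).s := fun m h1 h2 h3 =>
        Nat.find_min hex h2 ⟨h1, h3⟩
      refine ⟨Nat.find hex, hs.1, hs.2, fun m h1 h2 => ?_⟩
      have : A.U B ∈ (f m).s := by
        induction m, h1 using Nat.le_induction with
        | base => exact hn
        | succ m hm ih =>
          exact (((rel_U h (hR m)).1 (ih (by omega))).resolve_left (hmin m hm (by omega))).2
      exact (((rel_U h (hR m)).1 this).resolve_left (hmin m h1 h2)).1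

theorem hltl_complete {A : LTLFormula P}
    (hv : ∀ (V : ℕ → P → Prop) (n : ℕ), LTLSat V A n) : HLTL A := by
  by_contra hn
  obtain ⟨w, hw⟩ := lindenbaum hn
  obtain ⟨f, h0, hR, hf⟩ := fair (StepRel (subf A))
    (fun t => ⟨t.next, t, fun _ _ => Iff.rfl, fun _ _ => Iff.rfl⟩)
    (fun e t => ∃ C ∈ subf A, (subf A)[e]? = some C ∧ Pend C t)
    (fun e t => ∃ C ∈ subf A, (subf A)[e]? = some C ∧ Ful C t)
    (by
      rintro e t s ⟨C, hC, he, hp⟩ hnf hts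
      exact ⟨C, hC, he, pend_pers hC hp (fun hf => hnf ⟨C, hC, he, hf⟩) hts⟩)
    (by
      rintro e t ⟨C, hC, he, hp⟩
      obtain ⟨z, h1, h2⟩ := pend_reach hC hp
      exact ⟨z, h1, C, hC, he, h2⟩) w
  have := (truth f hR (fun e he i hp => by
    obtain ⟨k, hk⟩ := List.mem_iff_getElem?.1 he
    obtain ⟨j, hj, C, _, hk', hful⟩ := hf k i ⟨e, he, hk, hp⟩
    rw [hk] at hk'
    cases hk'
    exact ⟨j, hj, hful⟩) A (self_subf A) 0).1 (hv _ 0)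
  rw [h0] at this
  exact hw this

end Main

/-- Weak completeness of N(LTL∇) w.r.t. H(LTL) and w.r.t. LTL.
Every theorem of H(LTL) is LTL-derivable in N(LTL∇) (`⊢LTL A`, i.e. there is a
label `b` and an N(LTL∇)-derivation of `b:A*` with no open assumptions); in
particular every LTL-valid formula is LTL-derivable in N(LTL∇). -/
theorem weak_completeness {P : Type} :
    (∀ A : LTLFormula P, HLTL A →
      ∃ b : ℕ, Deriv (∅ : Set (GenForm P)) (.lab b ([] : List ℕ) (trNabla A))) ∧
    (∀ A : LTLFormula P, (∀ (V : ℕ → P → Prop) (n : ℕ), LTLSat V A n) →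
      ∃ b : ℕ, Deriv (∅ : Set (GenForm P)) (.lab b ([] : List ℕ) (trNabla A))) := by
  exact ⟨fun A h => ⟨0, hltl_dd h 0 [] ∅ Set.finite_empty (Set.Subset.refl _)⟩,
    fun A h => ⟨0, hltl_dd (hltl_complete h) 0 [] ∅ Set.finite_empty (Set.Subset.refl _)⟩⟩
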